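/- arXiv:2110.11110 — 5 statements merged into one kernel-verified Lean document; each statement's English description precedes it below -/
import Mathlib

section
/- Let P be a (Λ,F,Z,S) placement delivery array with Z < F, let L = (L_1,…,L_Λ) be an association profile with ∑_{λ=1}^Λ L_λ = K, and let G be the generalized array constructed from P and L. Then the number of distinct ordered pairs (s,i) that appear as entries of G equals ∑_{s=1}^{S} L_{τ_s}, where τ_s = min{λ ∈ [Λ] : s appears in column λ of P}. Consequently, the worst-case rate of the associated secretive coded caching scheme, defined as (number of distinct ordered pairs appearing in G) divided by (F−Z), equals (∑_{s=1}^{S} L_{τ_s})/(F−Z). -/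
/-- A `(K,F,Z,S)` placement delivery array: an `F × K` array with entries in `{⋆} ∪ [S]`
(`⋆` encoded as `none`) satisfying conditions C1, C2, C3. -/
def IsPDA (K F Z S : ℕ) (P : Fin F → Fin K → Option (Fin S)) : Prop :=
  (∀ k : Fin K, ((Finset.univ : Finset (Fin F)).filter (fun j => P j k = none)).card = Z) ∧
  (∀ s : Fin S, ∃ (j : Fin F) (k : Fin K), P j k = some s) ∧
  (∀ (j₁ j₂ : Fin F) (k₁ k₂ : Fin K) (s : Fin S), (j₁, k₁) ≠ (j₂, k₂) →
    P j₁ k₁ = some s → P j₂ k₂ = some s →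
    j₁ ≠ j₂ ∧ k₁ ≠ k₂ ∧ P j₁ k₂ = none ∧ P j₂ k₁ = none)

/-- The generalized array `G` constructed from a `(Λ,F,Z,S)` PDA `P` and an association
profile `L`: columns are indexed by pairs `(λ, i)` with `λ ∈ [Λ]`, `i ∈ [L λ]`
(`i` encoded `0`-based as `Fin (L λ)`, the ordered-pair entry records the `1`-based index
`i + 1`); the entry in row `j` and column `(λ, i)` is `⋆` if `P j λ = ⋆` and the ordered
pair `(P j λ, i)` otherwise. -/
def GArr {Λ F S : ℕ} (P : Fin F → Fin Λ → Option (Fin S)) (L : Fin Λ → ℕ)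
    (j : Fin F) (c : Σ l : Fin Λ, Fin (L l)) : Option (Fin S × ℕ) :=
  (P j c.1).map (fun s => (s, (c.2 : ℕ) + 1))

theorem biUnion_GArr_eq_image_sigma {Λ F S : ℕ} (P : Fin F → Fin Λ → Option (Fin S))
    (L : Fin Λ → ℕ) (hL : Antitone L) (tau : Fin S → Fin Λ)
    (htau : ∀ s : Fin S, IsLeast {l | ∃ j : Fin F, P j l = some s} (tau s)) :
    (Finset.univ : Finset (Fin F × Σ l : Fin Λ, Fin (L l))).biUnion
        (fun x => (GArr P L x.1 x.2).toFinset) =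
      ((Finset.univ : Finset (Fin S)).sigma (fun s => Finset.range (L (tau s)))).image
        (fun x => (x.1, x.2 + 1)) := by
  ext ⟨s, i⟩
  simp only [GArr, Finset.mem_biUnion, Finset.mem_univ, true_and, Option.mem_toFinset,
    Option.mem_def, Option.map_eq_some_iff, Prod.mk.injEq, Finset.mem_image, Finset.mem_sigma,
    Finset.mem_range]
  constructor
  · rintro ⟨⟨j, l, c⟩, t, ht, rfl, rfl⟩
    exact ⟨⟨t, c⟩, c.isLt.trans_le (hL ((htau t).2 ⟨j, ht⟩)), rfl, rfl⟩
  · rintro ⟨⟨t, c⟩, hc, rfl, rfl⟩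
    obtain ⟨j, hj⟩ := (htau t).1
    exact ⟨⟨j, tau t, c, hc⟩, t, hj, rfl, rfl⟩

theorem card_biUnion_GArr {Λ F S : ℕ} (P : Fin F → Fin Λ → Option (Fin S))
    (L : Fin Λ → ℕ) (hL : Antitone L) (tau : Fin S → Fin Λ)
    (htau : ∀ s : Fin S, IsLeast {l | ∃ j : Fin F, P j l = some s} (tau s)) :
    ((Finset.univ : Finset (Fin F × Σ l : Fin Λ, Fin (L l))).biUnion
        (fun x => (GArr P L x.1 x.2).toFinset)).card = ∑ s : Fin S, L (tau s) := by
  rw [biUnion_GArr_eq_image_sigma P L hL tau htau, Finset.card_image_of_injective]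
  · simp
  · rintro ⟨s, i⟩ ⟨t, j⟩ h
    simpa using h

/-- the number of distinct ordered pairs `(s,i)` appearing as entries of `G`
equals `∑_{s=1}^{S} L_{τ_s}`, where `τ_s` is the least column of `P` in which `s` appears;
consequently the worst-case rate `(#distinct pairs in G)/(F - Z)` equals
`(∑_{s} L_{τ_s})/(F - Z)`. -/
theorem statement0 (Λ F Z S K : ℕ) (hΛ : 0 < Λ) (hF : 0 < F) (hZ : 0 < Z) (hS : 0 < S)
    (hZF : Z < F)
    (P : Fin F → Fin Λ → Option (Fin S)) (hP : IsPDA Λ F Z S P)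
    (L : Fin Λ → ℕ) (hL : Antitone L) (hK : ∑ l : Fin Λ, L l = K)
    (tau : Fin S → Fin Λ)
    (htau : ∀ s : Fin S, (∃ j : Fin F, P j (tau s) = some s) ∧
      ∀ l : Fin Λ, (∃ j : Fin F, P j l = some s) → tau s ≤ l) :
    ((Finset.univ : Finset (Fin F × Σ l : Fin Λ, Fin (L l))).biUnion
        (fun x => (GArr P L x.1 x.2).toFinset)).card = ∑ s : Fin S, L (tau s) ∧
    ((((Finset.univ : Finset (Fin F × Σ l : Fin Λ, Fin (L l))).biUnion
        (fun x => (GArr P L x.1 x.2).toFinset)).card : ℚ) / ((F : ℚ) - (Z : ℚ)) =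
      (∑ s : Fin S, (L (tau s) : ℚ)) / ((F : ℚ) - (Z : ℚ))) := by
  have hcard := card_biUnion_GArr P L hL tau htau
  exact ⟨hcard, by rw [hcard, Nat.cast_sum]⟩
end

section
/- Let P be a (Λ,F,Z,S) placement delivery array, let L be an association profile, and let G be the generalized array constructed from P and L. Suppose the entries of G at two distinct positions, row j1 and column (λ1,i1), and row j2 and column (λ2,i2), are both equal to the same ordered pair (s,i). Then j1 ≠ j2, (λ1,i1) ≠ (λ2,i2), λ1 ≠ λ2, and the entries of G at row j1, column (λ2,i2) and at row j2, column (λ1,i1) are both equal to ⋆. (In particular, the sub-array of G formed by the rows and columns of the occurrences of (s,i) is, up to row and column permutations, a diagonal array with (s,i) on the diagonal and ⋆ elsewhere.) -/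
/-- if the entries of `G` at two distinct positions — row `j₁`, column
`(λ₁,i₁)` and row `j₂`, column `(λ₂,i₂)` — both equal the same ordered pair `(s,i)`, then
`j₁ ≠ j₂`, `(λ₁,i₁) ≠ (λ₂,i₂)`, `λ₁ ≠ λ₂`, and the entries of `G` at row `j₁`, column
`(λ₂,i₂)` and at row `j₂`, column `(λ₁,i₁)` are both `⋆`. -/
theorem statement3 (Λ F Z S : ℕ) (hΛ : 0 < Λ) (hF : 0 < F) (hZ : 0 < Z) (hS : 0 < S)
    (P : Fin F → Fin Λ → Option (Fin S)) (hP : IsPDA Λ F Z S P)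
    (L : Fin Λ → ℕ) (hL : Antitone L) :
    ∀ (j₁ j₂ : Fin F) (c₁ c₂ : Σ l : Fin Λ, Fin (L l)) (s : Fin S) (i : ℕ),
      (j₁, c₁) ≠ (j₂, c₂) →
      GArr P L j₁ c₁ = some (s, i) → GArr P L j₂ c₂ = some (s, i) →
      j₁ ≠ j₂ ∧ c₁ ≠ c₂ ∧ c₁.1 ≠ c₂.1 ∧ GArr P L j₁ c₂ = none ∧ GArr P L j₂ c₁ = none := by
  rintro j₁ j₂ ⟨l₁, a₁⟩ ⟨l₂, a₂⟩ s i hne h₁ h₂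
  simp only [GArr, Option.map_eq_some_iff, Option.map_eq_none_iff, Prod.mk.injEq] at h₁ h₂ ⊢
  obtain ⟨_, hs₁, rfl, hi₁⟩ := h₁
  obtain ⟨_, hs₂, rfl, hi₂⟩ := h₂
  have hpos : (j₁, l₁) ≠ (j₂, l₂) := by
    intro heq
    obtain ⟨rfl, rfl⟩ := Prod.mk.inj heq
    obtain rfl : a₁ = a₂ := Fin.ext (by omega)
    exact hne rfl
  obtain ⟨hj, hl, hs₁₂, hs₂₁⟩ := hP.2.2 j₁ j₂ l₁ l₂ _ hpos hs₁ hs₂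
  exact ⟨hj, fun hc => hl (congrArg Sigma.fst hc), hl, hs₁₂, hs₂₁⟩
end

section
/- Let Λ be a positive integer and let t be an integer with 0 ≤ t ≤ Λ−1. Then the MN array with parameter t is a (Λ, F, Z, S) placement delivery array with F = C(Λ,t), Z = C(Λ−1,t−1), and S = C(Λ,t+1); that is: each of its Λ columns contains exactly C(Λ−1,t−1) entries equal to ⋆, each (t+1)-element subset of [Λ] appears at least once as an entry, and whenever two distinct positions carry equal non-⋆ entries they lie in distinct rows and distinct columns and the two cross positions carry ⋆. -/
/-- The MN array with parameter `t` over ground set `[Λ]` (encoded as `Fin Λ`): rows are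
indexed by the `t`-element subsets `T` of `[Λ]`, columns by `λ ∈ [Λ]`; the entry at `(T,λ)`
is `⋆` (encoded `none`) if `λ ∈ T`, and the `(t+1)`-element set `T ∪ {λ}` otherwise. -/
def MN (Λ t : ℕ) (T : {T : Finset (Fin Λ) // T.card = t}) (l : Fin Λ) :
    Option (Finset (Fin Λ)) :=
  if l ∈ T.val then none else some (insert l T.val)

/-- Binomial coefficient with an integer lower index, following the convention
`C(n,k) = 0` for `k < 0`. -/
def chooseInt (n : ℕ) (k : ℤ) : ℕ := if 0 ≤ k then n.choose k.toNat else 0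

theorem mn_eq_none_iff {Λ t : ℕ} (T : {T : Finset (Fin Λ) // T.card = t}) (l : Fin Λ) :
    MN Λ t T l = none ↔ l ∈ T.val := by
  simp [MN]

theorem mn_eq_some_iff {Λ t : ℕ} (T : {T : Finset (Fin Λ) // T.card = t}) (l : Fin Λ)
    (A : Finset (Fin Λ)) : MN Λ t T l = some A ↔ l ∉ T.val ∧ insert l T.val = A := by
  simp [MN]

/-- Removing `a` identifies the `(s + 1)`-subsets containing `a` with the `s`-subsets of the
complement of `a`. -/
theorem Finset.card_filter_mem_powersetCard_succ {α : Type*} [Fintype α] [DecidableEq α]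
    (a : α) (s : ℕ) :
    ((Finset.univ.powersetCard (s + 1)).filter (a ∈ ·)).card =
      (Fintype.card α - 1).choose s := by
  rw [← Finset.card_univ, ← Finset.card_erase_of_mem (Finset.mem_univ a),
    ← Finset.card_powersetCard]
  refine Finset.card_nbij' (·.erase a) (insert a) ?_ ?_ ?_ ?_
  · intro T hT
    simp only [Finset.coe_filter, Set.mem_ofPred_eq, Finset.mem_powersetCard] at hT
    simp only [Finset.mem_coe, Finset.mem_powersetCard]
    exact ⟨Finset.erase_subset_erase a hT.1.1, by
      rw [Finset.card_erase_of_mem hT.2, hT.1.2, Nat.add_sub_cancel]⟩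
  · intro T hT
    simp only [Finset.mem_coe, Finset.mem_powersetCard] at hT
    have ha : a ∉ T := fun h => by simpa using hT.1 h
    simp [ha, hT.2]
  · intro T hT
    exact Finset.insert_erase (Finset.mem_filter.mp hT).2
  · intro T hT
    have ha : a ∉ T := fun h => by simpa using (Finset.mem_powersetCard.mp hT).1 h
    exact Finset.erase_insert ha

theorem card_mn_eq_none (Λ t : ℕ) (l : Fin Λ) :
    Nat.card {T : {T : Finset (Fin Λ) // T.card = t} // MN Λ t T l = none} =
      chooseInt (Λ - 1) ((t : ℤ) - 1) := by
  cases t with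
  | zero =>
    have : IsEmpty {T : {T : Finset (Fin Λ) // T.card = 0} // MN Λ 0 T l = none} := by
      refine ⟨fun ⟨T, hT⟩ => ?_⟩
      rw [mn_eq_none_iff, Finset.card_eq_zero.mp T.2] at hT
      simp at hT
    simp [chooseInt]
  | succ s =>
    have hc : chooseInt (Λ - 1) (((s + 1 : ℕ) : ℤ) - 1) = (Λ - 1).choose s := by
      simp [chooseInt]
    have key := Finset.card_filter_mem_powersetCard_succ l s
    rw [Fintype.card_fin] at key
    rw [hc, ← key, ← Nat.card_eq_finsetCard]
    refine Nat.card_congr ((Equiv.subtypeEquivRight fun T => mn_eq_none_iff T l).trans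
      ((Equiv.subtypeSubtypeEquivSubtypeInter _ (l ∈ ·)).trans
        (Equiv.subtypeEquivRight fun T => ?_)))
    simp [Finset.mem_powersetCard]

/-- for `0 ≤ t ≤ Λ−1`, the MN array with parameter `t` is a
`(Λ, C(Λ,t), C(Λ−1,t−1), C(Λ,t+1))` placement delivery array: it has `C(Λ,t)` rows, its
non-`⋆` entries are `(t+1)`-element subsets of `[Λ]` (of which there are `C(Λ,t+1)`), each
of its `Λ` columns contains exactly `C(Λ−1,t−1)` entries equal to `⋆` (C1), each
`(t+1)`-element subset of `[Λ]` appears at least once as an entry (C2), and whenever two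
distinct positions carry equal non-`⋆` entries they lie in distinct rows and distinct
columns and the two cross positions carry `⋆` (C3). -/
theorem statement8 (Λ t : ℕ) (hΛ : 0 < Λ) (ht : t ≤ Λ - 1) :
    Nat.card {T : Finset (Fin Λ) // T.card = t} = Nat.choose Λ t ∧
    Nat.card {A : Finset (Fin Λ) // A.card = t + 1} = Nat.choose Λ (t + 1) ∧
    (∀ (T : {T : Finset (Fin Λ) // T.card = t}) (l : Fin Λ) (A : Finset (Fin Λ)),
      MN Λ t T l = some A → A.card = t + 1) ∧
    (∀ l : Fin Λ,
      Nat.card {T : {T : Finset (Fin Λ) // T.card = t} // MN Λ t T l = none} =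
        chooseInt (Λ - 1) ((t : ℤ) - 1)) ∧
    (∀ A : Finset (Fin Λ), A.card = t + 1 →
      ∃ (T : {T : Finset (Fin Λ) // T.card = t}) (l : Fin Λ), MN Λ t T l = some A) ∧
    (∀ (T₁ T₂ : {T : Finset (Fin Λ) // T.card = t}) (l₁ l₂ : Fin Λ) (A : Finset (Fin Λ)),
      (T₁, l₁) ≠ (T₂, l₂) → MN Λ t T₁ l₁ = some A → MN Λ t T₂ l₂ = some A →
      T₁ ≠ T₂ ∧ l₁ ≠ l₂ ∧ MN Λ t T₁ l₂ = none ∧ MN Λ t T₂ l₁ = none) := by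
  refine ⟨by simp, by simp, ?_, card_mn_eq_none Λ t, ?_, ?_⟩
  · intro T l A h
    obtain ⟨hl, rfl⟩ := (mn_eq_some_iff T l A).mp h
    rw [Finset.card_insert_of_notMem hl, T.2]
  · intro A hA
    obtain ⟨l, hl⟩ : A.Nonempty := Finset.card_pos.mp (by omega)
    refine ⟨⟨A.erase l, by rw [Finset.card_erase_of_mem hl, hA, Nat.add_sub_cancel]⟩, l, ?_⟩
    exact (mn_eq_some_iff _ _ _).mpr ⟨Finset.notMem_erase l A, Finset.insert_erase hl⟩
  · intro T₁ T₂ l₁ l₂ A hne h₁ h₂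
    rw [mn_eq_some_iff] at h₁ h₂
    obtain ⟨hl₁, rfl⟩ := h₁
    obtain ⟨hl₂, hA⟩ := h₂
    have hl : l₁ ≠ l₂ := by
      rintro rfl
      refine hne (Prod.ext (Subtype.ext ?_) rfl)
      rw [← Finset.erase_insert hl₁, ← hA, Finset.erase_insert hl₂]
    have h₂₁ : l₂ ∈ T₁.val :=
      Finset.mem_of_mem_insert_of_ne (hA ▸ Finset.mem_insert_self l₂ T₂.val) hl.symm
    have h₁₂ : l₁ ∈ T₂.val :=
      Finset.mem_of_mem_insert_of_ne (hA ▸ Finset.mem_insert_self l₁ T₁.val) hl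
    refine ⟨?_, hl, (mn_eq_none_iff _ _).mpr h₂₁, (mn_eq_none_iff _ _).mpr h₁₂⟩
    rintro rfl
    exact hl₁ h₁₂
end

section
/- Let Λ be a positive integer and let t be an integer with 0 ≤ t ≤ Λ−1. Let T1, T2 be t-element subsets of [Λ] and λ1, λ2 ∈ [Λ] with λ1 ∉ T1, λ2 ∉ T2 and (T1,λ1) ≠ (T2,λ2). If T1 ∪ {λ1} = T2 ∪ {λ2}, then T1 ≠ T2, λ1 ≠ λ2, λ2 ∈ T1, and λ1 ∈ T2; that is, the MN array satisfies condition C3 of a placement delivery array. -/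
/-- for `0 ≤ t ≤ Λ−1`, if `T₁, T₂` are `t`-element subsets of `[Λ]` and
`λ₁ ∉ T₁`, `λ₂ ∉ T₂` with `(T₁,λ₁) ≠ (T₂,λ₂)` and `T₁ ∪ {λ₁} = T₂ ∪ {λ₂}`, then
`T₁ ≠ T₂`, `λ₁ ≠ λ₂`, `λ₂ ∈ T₁` and `λ₁ ∈ T₂`; that is, the MN array satisfies
condition C3 of a placement delivery array. -/
theorem statement10 (Λ t : ℕ) (hΛ : 0 < Λ) (ht : t ≤ Λ - 1)
    (T₁ T₂ : Finset (Fin Λ)) (l₁ l₂ : Fin Λ)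
    (hT₁ : T₁.card = t) (hT₂ : T₂.card = t)
    (hl₁ : l₁ ∉ T₁) (hl₂ : l₂ ∉ T₂)
    (hne : (T₁, l₁) ≠ (T₂, l₂))
    (heq : insert l₁ T₁ = insert l₂ T₂) :
    T₁ ≠ T₂ ∧ l₁ ≠ l₂ ∧ l₂ ∈ T₁ ∧ l₁ ∈ T₂ := by
  have hl : l₁ ≠ l₂ := by
    rintro rfl
    refine hne (Prod.ext ?_ rfl)
    change T₁ = T₂
    rw [← Finset.erase_insert hl₁, heq, Finset.erase_insert hl₂]
  have h₂ : l₂ ∈ T₁ :=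
    Finset.mem_of_mem_insert_of_ne (heq ▸ Finset.mem_insert_self l₂ T₂) hl.symm
  have h₁ : l₁ ∈ T₂ :=
    Finset.mem_of_mem_insert_of_ne (heq ▸ Finset.mem_insert_self l₁ T₁) hl
  exact ⟨fun h => hl₂ (h ▸ h₂), hl, h₂, h₁⟩
end

section
/- Consider a secretive shared-cache scheme with parameters (Λ, K, M, M_U, N, B) and rate R, with users ordered so that user k is attached to cache λ(k) = min{λ ∈ [Λ] : L_1 + ⋯ + L_λ ≥ k}. Then for every integer s with 1 ≤ s ≤ min(N/2, K), (⌊N/s⌋ − 1)·R ≥ (s·⌊N/s⌋ − 1) − (λ(s) − 1)·M − (s − 1)·M_U; equivalently, R ≥ max over such s of (s·⌊N/s⌋ − 1 − (λ(s)−1)M − (s−1)M_U)/(⌊N/s⌋ − 1). -/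
noncomputable section

/-- Probability of an event `E` on a finite sample space with weight function `p`. -/
def pr {Ω : Type*} [Fintype Ω] (p : Ω → ℝ) (E : Set Ω) : ℝ :=
  ∑ ω : Ω, E.indicator p ω

/-- Shannon entropy (in bits) of a random variable `X` on a finite probability space
`(Ω, p)`: `H(X) = -∑_x P[X = x] log₂ P[X = x]`, written as the expectation
`∑_ω p ω · (− log₂ P[X = X ω])`. -/
def ent {Ω α : Type*} [Fintype Ω] (p : Ω → ℝ) (X : Ω → α) : ℝ :=
  ∑ ω : Ω, p ω * (-Real.logb 2 (pr p {ω' | X ω' = X ω}))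

/-- Conditional Shannon entropy `H(X | Y) = H(X, Y) − H(Y)` in bits. -/
def condEnt {Ω α β : Type*} [Fintype Ω] (p : Ω → ℝ) (X : Ω → α) (Y : Ω → β) : ℝ :=
  ent p (fun ω => (X ω, Y ω)) - ent p Y

/-- Mutual information `I(X ; Y) = H(X) + H(Y) − H(X, Y)` in bits. -/
def mutInf {Ω α β : Type*} [Fintype Ω] (p : Ω → ℝ) (X : Ω → α) (Y : Ω → β) : ℝ :=
  ent p X + ent p Y - ent p (fun ω => (X ω, Y ω))

section ShannonEntropy

open scoped Classical in
theorem pr_eq_sum_ite {Ω : Type*} [Fintype Ω] (p : Ω → ℝ) (E : Set Ω) :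
    pr p E = ∑ ω : Ω, if ω ∈ E then p ω else 0 := by
  unfold pr
  exact Finset.sum_congr rfl fun ω _ => by rw [Set.indicator_apply]

theorem pr_mono {Ω : Type*} [Fintype Ω] {p : Ω → ℝ} (hp : ∀ ω, 0 ≤ p ω) {E F : Set Ω}
    (h : ∀ ω ∈ E, p ω ≠ 0 → ω ∈ F) : pr p E ≤ pr p F := by
  classical
  rw [pr_eq_sum_ite, pr_eq_sum_ite]
  refine Finset.sum_le_sum fun ω _ => ?_
  by_cases h0 : p ω = 0
  · simp [h0]
  · by_cases hE : ω ∈ E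
    · simp [hE, h ω hE h0]
    · rw [if_neg hE]
      split_ifs
      exacts [hp ω, le_rfl]

theorem le_pr_of_mem {Ω : Type*} [Fintype Ω] {p : Ω → ℝ} (hp : ∀ ω, 0 ≤ p ω) {E : Set Ω} {ω : Ω}
    (h : ω ∈ E) : p ω ≤ pr p E := by
  have := Finset.single_le_sum (f := fun ω => E.indicator p ω)
    (fun ω _ => Set.indicator_nonneg (fun ω _ => hp ω) ω) (Finset.mem_univ ω)
  simpa [pr, h] using this

theorem pr_fiber_pos {Ω α : Type*} [Fintype Ω] {p : Ω → ℝ} (hp : ∀ ω, 0 ≤ p ω) (X : Ω → α) {ω : Ω}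
    (h : p ω ≠ 0) : 0 < pr p {ω' | X ω' = X ω} :=
  (lt_of_le_of_ne (hp ω) h.symm).trans_le (le_pr_of_mem hp rfl)

/-- `X` determines `Y` almost surely under the weights `p`. -/
def Determines {Ω α β : Type*} (p : Ω → ℝ) (X : Ω → α) (Y : Ω → β) : Prop :=
  ∀ ω ω', p ω ≠ 0 → p ω' ≠ 0 → X ω = X ω' → Y ω = Y ω'

theorem ent_le_of_determines {Ω α β : Type*} [Fintype Ω] {p : Ω → ℝ} (hp : ∀ ω, 0 ≤ p ω)
    {X : Ω → α} {Y : Ω → β} (h : Determines p X Y) : ent p Y ≤ ent p X := by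
  refine Finset.sum_le_sum fun ω _ => ?_
  by_cases h0 : p ω = 0
  · simp [h0]
  · refine mul_le_mul_of_nonneg_left (neg_le_neg ?_) (hp ω)
    exact Real.logb_le_logb_of_le one_lt_two (pr_fiber_pos hp X h0)
      (pr_mono hp fun ω' hω' h' => h ω' ω h' h0 hω')

theorem determines_of_condEnt_eq_zero {Ω α β : Type*} [Fintype Ω] {p : Ω → ℝ}
    (hp : ∀ ω, 0 ≤ p ω) {X : Ω → α} {Y : Ω → β} (h : condEnt p Y X = 0) :
    Determines p X Y := by
  classical
  intro ω ω' h0 h0' hX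
  have hle : ∀ ω, pr p {ω' | (Y ω', X ω') = (Y ω, X ω)} ≤ pr p {ω' | X ω' = X ω} := fun ω =>
    pr_mono hp fun ω' hω' _ => (Prod.ext_iff.1 hω').2
  have hterm : ∀ ω ∈ Finset.univ,
      0 ≤ p ω * (-Real.logb 2 (pr p {ω' | (Y ω', X ω') = (Y ω, X ω)})) -
        p ω * (-Real.logb 2 (pr p {ω' | X ω' = X ω})) := by
    intro ω _
    by_cases h0 : p ω = 0
    · simp [h0]
    · rw [← mul_sub]
      refine mul_nonneg (hp ω) (sub_nonneg.2 (neg_le_neg ?_))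
      exact Real.logb_le_logb_of_le one_lt_two
        (pr_fiber_pos hp (fun ω => (Y ω, X ω)) h0) (hle ω)
  unfold condEnt ent at h
  rw [← Finset.sum_sub_distrib, Finset.sum_eq_zero_iff_of_nonneg hterm] at h
  have hω := h ω (Finset.mem_univ ω)
  rw [← mul_sub, mul_eq_zero, or_iff_right h0, sub_eq_zero, neg_inj] at hω
  have heq := Real.logb_injOn_pos one_lt_two (pr_fiber_pos hp (fun ω => (Y ω, X ω)) h0)
    (pr_fiber_pos hp X h0) hω
  by_contra hY
  have hlt : pr p {ω' | (Y ω', X ω') = (Y ω, X ω)} < pr p {ω' | X ω' = X ω} := by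
    rw [pr_eq_sum_ite, pr_eq_sum_ite]
    refine Finset.sum_lt_sum (fun ν _ => ?_) ⟨ω', Finset.mem_univ _, ?_⟩
    · simp only [Set.mem_ofPred_eq, Prod.mk.injEq]
      split_ifs with h1 h2 h2
      exacts [le_rfl, absurd h1.2 h2, hp ν, le_rfl]
    · have hY' : Y ω' ≠ Y ω := fun h => hY h.symm
      simp only [Set.mem_ofPred_eq, Prod.mk.injEq, hY', hX, false_and, if_false, if_true]
      exact lt_of_le_of_ne (hp ω') h0'.symm
  exact hlt.ne heq

theorem sum_mul_product_ratio_le_one {Ω α β : Type*} [Fintype Ω] {p : Ω → ℝ}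
    (hp : ∀ ω, 0 ≤ p ω) (hp1 : ∑ ω, p ω = 1) (X : Ω → α) (Y : Ω → β) :
    ∑ ω, p ω * (pr p {ω' | X ω' = X ω} * pr p {ω' | Y ω' = Y ω} /
      pr p {ω' | (X ω', Y ω') = (X ω, Y ω)}) ≤ 1 := by
  classical
  set P : Ω → ℝ := fun ω => pr p {ω' | (X ω', Y ω') = (X ω, Y ω)}
  have hinner : ∀ a b : Ω, ∑ ω, (if X a = X ω ∧ Y b = Y ω then p ω / P ω else 0) ≤ 1 := by
    intro a b
    by_cases hex : ∃ ν, X a = X ν ∧ Y b = Y ν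
    · obtain ⟨ν, hν⟩ := hex
      have hnum : P ν = ∑ ω, if X a = X ω ∧ Y b = Y ω then p ω else 0 := by
        refine Finset.sum_congr rfl fun ω _ => ?_
        rw [hν.1, hν.2]
        split_ifs with h
        · refine Set.indicator_of_mem ?_ p
          exact Prod.ext h.1.symm h.2.symm
        · refine Set.indicator_of_notMem (fun h' => h ?_) p
          exact ⟨(Prod.ext_iff.1 h').1.symm, (Prod.ext_iff.1 h').2.symm⟩
      have : ∑ ω, (if X a = X ω ∧ Y b = Y ω then p ω / P ω else 0) = P ν / P ν := by
        rw [Finset.sum_congr rfl (g := fun ω => (if X a = X ω ∧ Y b = Y ω then p ω else 0) / P ν),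
          ← Finset.sum_div, ← hnum]
        intro ω _
        split_ifs with h
        · simp only [P, ← hν.1, ← hν.2, h.1, h.2]
        · rw [zero_div]
      rw [this]
      exact div_self_le_one _
    · push Not at hex
      rw [Finset.sum_eq_zero]
      · exact zero_le_one
      · exact fun ω _ => if_neg fun h => hex ω h.1 h.2
  calc _ = ∑ ω, ∑ a, ∑ b, p a * p b * (if X a = X ω ∧ Y b = Y ω then p ω / P ω else 0) := by
        refine Finset.sum_congr rfl fun ω _ => ?_
        change p ω * (_ / P ω) = _
        rw [pr_eq_sum_ite, pr_eq_sum_ite, Finset.sum_mul_sum, Finset.sum_div, Finset.mul_sum]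
        refine Finset.sum_congr rfl fun a _ => ?_
        rw [Finset.sum_div, Finset.mul_sum]
        refine Finset.sum_congr rfl fun b _ => ?_
        by_cases h1 : X a = X ω <;> by_cases h2 : Y b = Y ω <;> simp [h1, h2]
        ring
    _ = ∑ a, ∑ b, p a * p b * ∑ ω, (if X a = X ω ∧ Y b = Y ω then p ω / P ω else 0) := by
        rw [Finset.sum_comm]
        refine Finset.sum_congr rfl fun a _ => ?_
        rw [Finset.sum_comm]
        exact Finset.sum_congr rfl fun b _ => (Finset.mul_sum _ _ _).symm
    _ ≤ ∑ a, ∑ b, p a * p b * 1 := by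
        gcongr with a _ b _
        · exact mul_nonneg (hp a) (hp b)
        · exact hinner a b
    _ = 1 := by
        simp only [mul_one]
        rw [← Finset.sum_mul_sum, hp1, mul_one]

theorem ent_prod_le {Ω α β : Type*} [Fintype Ω] {p : Ω → ℝ}
    (hp : ∀ ω, 0 ≤ p ω) (hp1 : ∑ ω, p ω = 1) (X : Ω → α) (Y : Ω → β) :
    ent p (fun ω => (X ω, Y ω)) ≤ ent p X + ent p Y := by
  have hlog : 0 < Real.log 2 := Real.log_pos one_lt_two
  set r : Ω → ℝ := fun ω => pr p {ω' | X ω' = X ω} * pr p {ω' | Y ω' = Y ω} /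
      pr p {ω' | (X ω', Y ω') = (X ω, Y ω)}
  have key : ent p (fun ω => (X ω, Y ω)) - (ent p X + ent p Y) ≤
      ∑ ω, p ω * ((r ω - 1) / Real.log 2) := by
    unfold ent
    rw [← Finset.sum_add_distrib, ← Finset.sum_sub_distrib]
    refine Finset.sum_le_sum fun ω _ => ?_
    by_cases h0 : p ω = 0
    · simp [h0]
    · have hX := pr_fiber_pos hp X h0
      have hY := pr_fiber_pos hp Y h0
      have hXY := pr_fiber_pos hp (fun ω => (X ω, Y ω)) h0
      rw [← mul_add, ← mul_sub]
      refine mul_le_mul_of_nonneg_left ?_ (hp ω)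
      have hr : Real.logb 2 (r ω) ≤ (r ω - 1) / Real.log 2 := by
        unfold Real.logb
        gcongr
        exact Real.log_le_sub_one_of_pos (div_pos (mul_pos hX hY) hXY)
      have hr' : Real.logb 2 (r ω) = _ := Real.logb_div (mul_pos hX hY).ne' hXY.ne'
      rw [Real.logb_mul hX.ne' hY.ne'] at hr'
      linarith
  have hsum : ∑ ω, p ω * ((r ω - 1) / Real.log 2) = (∑ ω, p ω * r ω - 1) / Real.log 2 := by
    simp only [mul_div_assoc', mul_sub, mul_one]
    rw [← Finset.sum_div, Finset.sum_sub_distrib, hp1]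
  have : (∑ ω, p ω * r ω - 1) / Real.log 2 ≤ 0 :=
    div_nonpos_of_nonpos_of_nonneg
      (sub_nonpos.2 (sum_mul_product_ratio_le_one hp hp1 X Y)) hlog.le
  linarith

theorem ent_pi_le_sum {Ω ι : Type*} {T : ι → Type*} [Fintype Ω] {p : Ω → ℝ}
    (hp : ∀ ω, 0 ≤ p ω) (hp1 : ∑ ω, p ω = 1) (F : ∀ i, Ω → T i) (S : Finset ι) :
    ent p (fun ω (i : S) => F i ω) ≤ ∑ i ∈ S, ent p (F i) := by
  classical
  induction S using Finset.induction_on with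
  | empty =>
    have h1 : ∀ ω : Ω, {ω' : Ω | (fun i : (∅ : Finset ι) => F i.1 ω') = fun i : (∅ : Finset ι) => F i.1 ω} =
        Set.univ := fun ω => Set.eq_univ_of_forall fun ω' =>
      funext fun i => absurd i.2 (Finset.notMem_empty _)
    simp [ent, h1, pr, hp1]
  | insert a S ha ih =>
    rw [Finset.sum_insert ha]
    refine (ent_le_of_determines hp (X := fun ω => (F a ω, fun i : S => F i ω)) ?_).trans
      ((ent_prod_le hp hp1 _ _).trans (by gcongr))
    intro ω ω' _ _ h
    simp only [Prod.mk.injEq] at h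
    funext ⟨i, hi⟩
    obtain rfl | hi := Finset.mem_insert.1 hi
    · exact h.1
    · exact congrFun h.2 ⟨i, hi⟩

theorem ent_pi_le_card_mul {Ω ι : Type*} {T : ι → Type*} [Fintype Ω] {p : Ω → ℝ}
    (hp : ∀ ω, 0 ≤ p ω) (hp1 : ∑ ω, p ω = 1) (F : ∀ i, Ω → T i) (S : Finset ι) {c : ℝ}
    (hc : ∀ i, ent p (F i) ≤ c) :
    ent p (fun ω (i : S) => F i ω) ≤ S.card * c := by
  refine (ent_pi_le_sum hp hp1 F S).trans ?_
  simpa using Finset.sum_le_card_nsmul S (fun i => ent p (F i)) c fun i _ => hc i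

theorem ent_eq_of_pr_fiber {Ω α : Type*} [Fintype Ω] {p : Ω → ℝ} (hp1 : ∑ ω, p ω = 1)
    {X : Ω → α} {b : ℕ} (h : ∀ ω, pr p {ω' | X ω' = X ω} = 1 / 2 ^ b) : ent p X = b := by
  have hb : -Real.logb 2 (1 / 2 ^ b) = b := by
    rw [one_div, Real.logb_inv, neg_neg, Real.logb_pow, Real.logb_self_eq_one one_lt_two, mul_one]
  simp only [ent, h, hb]
  rw [← Finset.sum_mul, hp1, one_mul]

end ShannonEntropy

/-- cut-set lower bound: for any secretive shared-cache scheme with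
parameters `(Λ, K, M, M_U, N, B)` and rate `R`, with users ordered so that user `k`
(1-indexed) is attached to cache `λ(k) = min{λ : L₁ + ⋯ + L_λ ≥ k}`, for every integer `s`
with `1 ≤ s ≤ min(N/2, K)` one has
`(⌊N/s⌋ − 1)·R ≥ (s·⌊N/s⌋ − 1) − (λ(s) − 1)·M − (s − 1)·M_U`, and equivalently
`R ≥ (s·⌊N/s⌋ − 1 − (λ(s)−1)M − (s−1)M_U)/(⌊N/s⌋ − 1)`.
Users, caches and files are 0-indexed via `Fin`, so user `s` is `⟨s−1,_⟩ : Fin K` and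
`λ(s) − 1` is the `Fin Λ`-value `(lam ⟨s−1,_⟩).val`. -/
theorem statement11
    -- parameters
    (Λ K N B : ℕ) (M MU R : ℝ) (hΛ : 0 < Λ) (hB : 0 < B)
    -- association profile and user-to-cache assignment
    (L : Fin Λ → ℕ) (hL : Antitone L) (hKsum : ∑ l : Fin Λ, L l = K)
    (lam : Fin K → Fin Λ)
    (hlam : ∀ k : Fin K, (k.val + 1 ≤ ∑ l ∈ Finset.Iic (lam k), L l) ∧
      ∀ l' : Fin Λ, k.val + 1 ≤ ∑ l ∈ Finset.Iic l', L l → lam k ≤ l')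
    -- the underlying finite probability space
    (Ω : Type) [Fintype Ω] (p : Ω → ℝ) (hp0 : ∀ ω : Ω, 0 ≤ p ω) (hp1 : ∑ ω : Ω, p ω = 1)
    -- the `N` files: mutually independent, each uniform over a set of size `2^B`
    (W : Fin N → Ω → Fin (2 ^ B))
    (hWunif : ∀ (n : Fin N) (w : Fin (2 ^ B)), pr p {ω | W n ω = w} = 1 / (2 ^ B : ℝ))
    (hWind : ∀ w : Fin N → Fin (2 ^ B),
      pr p {ω | ∀ n : Fin N, W n ω = w n} = ∏ n : Fin N, pr p {ω | W n ω = w n})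
    -- helper-cache contents
    (ZT : Fin Λ → Type) (Z : ∀ l : Fin Λ, Ω → ZT l)
    (hZ : ∀ l : Fin Λ, ent p (Z l) ≤ M * B)
    -- user-cache contents
    (UT : Fin K → Type) (U : ∀ k : Fin K, Ω → UT k)
    (hU : ∀ k : Fin K, ent p (U k) ≤ MU * B)
    -- transmissions
    (XT : (Fin K → Fin N) → Type) (X : ∀ d : Fin K → Fin N, Ω → XT d)
    (hX : ∀ d : Fin K → Fin N, ent p (X d) ≤ R * B)
    -- decodability
    (hdec : ∀ (d : Fin K → Fin N) (k : Fin K),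
      condEnt p (W (d k)) (fun ω => (X d ω, Z (lam k) ω, U k ω)) = 0)
    -- secrecy
    (hsec : ∀ (d : Fin K → Fin N) (k : Fin K),
      mutInf p (fun ω (n : {n : Fin N // n ≠ d k}) => W n.val ω)
        (fun ω => (X d ω, Z (lam k) ω, U k ω)) = 0) :
    ∀ (s : ℕ), ∀ _hs1 : 1 ≤ s, ∀ _hs2 : 2 * s ≤ N, ∀ _hsK : s ≤ K,
      (((N / s : ℕ) : ℝ) - 1) * R ≥
        ((s : ℝ) * ((N / s : ℕ) : ℝ) - 1) - ((lam ⟨s - 1, by omega⟩).val : ℝ) * M -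
          ((s : ℝ) - 1) * MU ∧
      R ≥ ((s : ℝ) * ((N / s : ℕ) : ℝ) - 1 - ((lam ⟨s - 1, by omega⟩).val : ℝ) * M -
          ((s : ℝ) - 1) * MU) / (((N / s : ℕ) : ℝ) - 1) := by
  intro s hs1 hs2 hsK
  have hN : 0 < N := by omega
  set m := N / s with hm
  have hm2 : 2 ≤ m := (Nat.le_div_iff_mul_le hs1).2 hs2
  have hsm : s * m ≤ N := Nat.mul_div_le N s
  set k₀ : Fin K := ⟨s - 1, by omega⟩ with hk₀
  let file : ℕ → Fin N := fun n => ⟨n % N, Nat.mod_lt _ hN⟩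
  have hfile : ∀ n : Fin N, file n = n := fun n => Fin.ext (Nat.mod_eq_of_lt n.2)
  let d : ℕ → Fin K → Fin N := fun j k => file (j * s + k)
  have hlam_mono : ∀ k ≤ k₀, lam k ≤ lam k₀ := fun k hk =>
    (hlam k).2 _ ((Nat.succ_le_succ hk).trans (hlam k₀).1)
  have hWent : ∀ n, ent p (W n) = B := fun n => ent_eq_of_pr_fiber hp1 fun ω => hWunif n _
  have hWall : ent p (fun ω n => W n ω) = (N * B : ℕ) := by
    refine ent_eq_of_pr_fiber hp1 fun ω => ?_
    have := hWind fun n => W n ω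
    simp only [hWunif, Finset.prod_const, Finset.card_univ, Fintype.card_fin] at this
    simp only [funext_iff, this]
    rw [one_div_pow, ← pow_mul, mul_comm]
  let A := fun ω => (X (d 0) ω, Z (lam k₀) ω, U k₀ ω)
  let Wothers := fun ω (n : {n : Fin N // n ≠ d 0 k₀}) => W n.val ω
  have hWothers : ((N * B : ℕ) : ℝ) ≤ ent p Wothers + B := by
    rw [← hWall, ← hWent (d 0 k₀)]
    refine (ent_le_of_determines hp0 ?_).trans (ent_prod_le hp0 hp1 _ _)
    intro ω ω' _ _ h
    simp only [Prod.mk.injEq] at h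
    funext n
    by_cases hn : n = d 0 k₀
    · exact hn ▸ h.2
    · exact congrFun h.1 ⟨n, hn⟩
  have hsecA : ent p Wothers + ent p A - ent p (fun ω => (Wothers ω, A ω)) = 0 := hsec (d 0) k₀
  let Xs := fun ω (j : Finset.Ico 1 m) => X (d j) ω
  let Zs := fun ω (l : Finset.Iio (lam k₀)) => Z l ω
  let Us := fun ω (k : Finset.Iio k₀) => U k ω
  let Ws := fun ω (n : Finset.Ico (s * m) N) => W (file n) ω
  have hdet : Determines p (fun ω => (A ω, Xs ω, Zs ω, Us ω, Ws ω))
      (fun ω => (Wothers ω, A ω)) := by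
    intro ω ω' h0 h0' h
    simp only [Prod.mk.injEq] at h
    obtain ⟨hA, hXs, hZs, hUs, hWs⟩ := h
    refine Prod.ext ?_ hA
    simp only [A, Prod.mk.injEq] at hA
    funext ⟨n, _⟩
    change W n ω = W n ω'
    by_cases hn : s * m ≤ n
    · have := congrFun hWs ⟨n, Finset.mem_Ico.2 ⟨hn, n.2⟩⟩
      simpa only [Ws, hfile] using this
    · have hj : (n : ℕ) / s < m := Nat.div_lt_of_lt_mul (not_le.1 hn)
      have hk : (n : ℕ) % s < s := Nat.mod_lt _ hs1
      let k : Fin K := ⟨n % s, hk.trans_le hsK⟩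
      have hkk : k ≤ k₀ := Nat.le_sub_one_of_lt hk
      have hdn : d (n / s) k = n := by
        change file (n / s * s + n % s) = n
        rw [Nat.div_add_mod', hfile]
      rw [← hdn]
      refine determines_of_condEnt_eq_zero hp0 (hdec (d (n / s)) k) ω ω' h0 h0' ?_
      refine Prod.ext ?_ (Prod.ext ?_ ?_)
      · obtain hz | hpos := Nat.eq_zero_or_pos ((n : ℕ) / s)
        · change X (d (n / s)) ω = X (d (n / s)) ω'
          rw [hz]
          exact hA.1
        · exact congrFun hXs ⟨_, Finset.mem_Ico.2 ⟨hpos, hj⟩⟩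
      · obtain hz | hlt := (hlam_mono k hkk).eq_or_lt
        · change Z (lam k) ω = Z (lam k) ω'
          rw [hz]
          exact hA.2.1
        · exact congrFun hZs ⟨_, Finset.mem_Iio.2 hlt⟩
      · obtain hz | hlt := hkk.eq_or_lt
        · change U k ω = U k ω'
          rw [hz]
          exact hA.2.2
        · exact congrFun hUs ⟨_, Finset.mem_Iio.2 hlt⟩
  have h₁ := ent_le_of_determines hp0 hdet
  have h₂ := ent_prod_le hp0 hp1 A fun ω => (Xs ω, Zs ω, Us ω, Ws ω)
  have h₃ := ent_prod_le hp0 hp1 Xs fun ω => (Zs ω, Us ω, Ws ω)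
  have h₄ := ent_prod_le hp0 hp1 Zs fun ω => (Us ω, Ws ω)
  have h₅ := ent_prod_le hp0 hp1 Us Ws
  have hXs : ent p Xs ≤ _ := ent_pi_le_card_mul hp0 hp1 (fun j => X (d j)) _ fun j => hX (d j)
  have hZs : ent p Zs ≤ _ := ent_pi_le_card_mul hp0 hp1 Z _ hZ
  have hUs : ent p Us ≤ _ := ent_pi_le_card_mul hp0 hp1 U _ hU
  have hWs : ent p Ws ≤ _ :=
    ent_pi_le_card_mul hp0 hp1 (fun n => W (file n)) _ fun n => (hWent (file n)).le
  rw [Nat.card_Ico, Nat.cast_sub (by omega), Nat.cast_one] at hXs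
  rw [Fin.card_Iio] at hZs hUs
  rw [show (k₀ : ℕ) = s - 1 from rfl, Nat.cast_sub hs1, Nat.cast_one] at hUs
  rw [Nat.card_Ico, Nat.cast_sub hsm, Nat.cast_mul] at hWs
  rw [Nat.cast_mul] at hWothers
  have hBpos : (0 : ℝ) < B := Nat.cast_pos.2 hB
  have hmain : ((s : ℝ) * m - 1) - ((lam k₀ : ℕ) : ℝ) * M - ((s : ℝ) - 1) * MU ≤
      ((m : ℝ) - 1) * R := by
    refine le_of_mul_le_mul_right ?_ hBpos
    linarith
  have hmpos : (0 : ℝ) < (m : ℝ) - 1 := by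
    have : (2 : ℝ) ≤ m := by exact_mod_cast hm2
    linarith
  refine ⟨hmain, (div_le_iff₀ hmpos).2 ?_⟩
  linarith
end
end
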